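/- Let f be a smooth function on a Riemannian manifold M with |∇f| ≠ 0 on an open set U, let X = ∇f/|∇f|², and let {e₁,...,e_n} be an orthonormal frame at a point p ∈ U. Then at p: div(∇_X X) = −2 X(∇²f(X,X)) + 4 ∇²f(X,X)² − 2|X|² ∇²f(X,X) Δf − 4|X|² Σ_{i=1}^n ∇²f(e_i, X)² + (|X|⁴/2) Δ|∇f|². -/

import Mathlib

/-!
We formalize Riemannian geometry on a coordinate chart: a Riemannian metric on an open
subset of `ℝⁿ` is given by a smooth field of positive definite symmetric matrices `g`.
All of the classical objects (Levi-Civita connection via Christoffel symbols, curvature,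
Ricci curvature, gradient, Hessian, Laplace–Beltrami operator, divergence, covariant
derivatives of vector fields) are defined below by their standard coordinate formulas.
-/

open scoped BigOperators
open Matrix MeasureTheory

noncomputable section

/-- `i`-th partial derivative of a scalar function on `ℝⁿ`. -/
def pd {n : ℕ} (i : Fin n) (h : (Fin n → ℝ) → ℝ) (x : Fin n → ℝ) : ℝ :=
  fderiv ℝ h x (Pi.single i 1)

/-- Directional derivative of the scalar function `h` at `x` in the direction of the
tangent vector `v` (i.e. `v(h)` at `x`). -/
def dirDeriv {n : ℕ} (v : Fin n → ℝ) (h : (Fin n → ℝ) → ℝ) (x : Fin n → ℝ) : ℝ :=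
  fderiv ℝ h x v

/-- The inner product `⟨v, w⟩` of the tangent vectors `v`, `w` at the point `x`,
with respect to the metric `g`. -/
def gip {n : ℕ} (g : (Fin n → ℝ) → Matrix (Fin n) (Fin n) ℝ) (x v w : Fin n → ℝ) : ℝ :=
  ∑ i, ∑ j, g x i j * v i * w j

/-- `g` is a (smooth) Riemannian metric on the set `U ⊆ ℝⁿ`: a smooth field of
symmetric positive definite matrices. -/
def IsRiemannianMetricOn {n : ℕ} (g : (Fin n → ℝ) → Matrix (Fin n) (Fin n) ℝ)
    (U : Set (Fin n → ℝ)) : Prop :=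
  (∀ i j, ContDiffOn ℝ (⊤ : ℕ∞) (fun x => g x i j) U) ∧ ∀ x ∈ U, (g x).PosDef

/-- Christoffel symbols `Γ^k_{ij}` of the Levi-Civita connection of the metric `g`. -/
def christoffel {n : ℕ} (g : (Fin n → ℝ) → Matrix (Fin n) (Fin n) ℝ) (k i j : Fin n)
    (x : Fin n → ℝ) : ℝ :=
  (1 / 2) * ∑ l, (g x)⁻¹ k l *
    (pd i (fun y => g y j l) x + pd j (fun y => g y i l) x - pd l (fun y => g y i j) x)

/-- Components `R^l_{ijk}` of the Riemann curvature tensor of `g`, so that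
`R(∂ᵢ,∂ⱼ)∂ₖ = ∑ l, R^l_{ijk} ∂_l` where `R(X,Y)Z = ∇_X ∇_Y Z - ∇_Y ∇_X Z - ∇_[X,Y] Z`. -/
def riemann {n : ℕ} (g : (Fin n → ℝ) → Matrix (Fin n) (Fin n) ℝ) (l i j k : Fin n)
    (x : Fin n → ℝ) : ℝ :=
  pd i (christoffel g l j k) x - pd j (christoffel g l i k) x
    + ∑ m, (christoffel g l i m x * christoffel g m j k x
        - christoffel g l j m x * christoffel g m i k x)

/-- The Ricci curvature `Rc(v,w)` at `x`, for tangent vectors `v`, `w`: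
`Rc(Y,Z) = tr (W ↦ R(W,Y)Z)`. -/
def ricci {n : ℕ} (g : (Fin n → ℝ) → Matrix (Fin n) (Fin n) ℝ) (x v w : Fin n → ℝ) : ℝ :=
  ∑ i, ∑ j, (∑ k, riemann g k k i j x) * v i * w j

/-- The covariant derivative `∇_v V` at `x` of the vector field `V` in the
direction of the tangent vector `v` at `x`. -/
def covDeriv {n : ℕ} (g : (Fin n → ℝ) → Matrix (Fin n) (Fin n) ℝ)
    (V : (Fin n → ℝ) → Fin n → ℝ) (v : Fin n → ℝ) (x : Fin n → ℝ) : Fin n → ℝ :=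
  fun k => (∑ i, v i * pd i (fun y => V y k) x)
    + ∑ i, ∑ j, christoffel g k i j x * v i * V x j

/-- The divergence `div V = tr (Y ↦ ∇_Y V)` of the vector field `V`. -/
def divVF {n : ℕ} (g : (Fin n → ℝ) → Matrix (Fin n) (Fin n) ℝ)
    (V : (Fin n → ℝ) → Fin n → ℝ) (x : Fin n → ℝ) : ℝ :=
  ∑ k, covDeriv g V (Pi.single k 1) x k

/-- The gradient `∇f` of a scalar function `f`, with respect to the metric `g`. -/
def grad {n : ℕ} (g : (Fin n → ℝ) → Matrix (Fin n) (Fin n) ℝ) (f : (Fin n → ℝ) → ℝ)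
    (x : Fin n → ℝ) : Fin n → ℝ :=
  fun i => ∑ j, (g x)⁻¹ i j * pd j f x

/-- `|∇f|²` at `x`. -/
def gradNormSq {n : ℕ} (g : (Fin n → ℝ) → Matrix (Fin n) (Fin n) ℝ) (f : (Fin n → ℝ) → ℝ)
    (x : Fin n → ℝ) : ℝ :=
  gip g x (grad g f x) (grad g f x)

/-- The components `(∇²f)_{ij}` of the Hessian of `f`. -/
def hessC {n : ℕ} (g : (Fin n → ℝ) → Matrix (Fin n) (Fin n) ℝ) (f : (Fin n → ℝ) → ℝ)
    (i j : Fin n) (x : Fin n → ℝ) : ℝ :=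
  pd i (pd j f) x - ∑ k, christoffel g k i j x * pd k f x

/-- The Hessian `∇²f(v,w) = ⟨∇_v ∇f, w⟩` evaluated on tangent vectors `v`, `w` at `x`. -/
def hess {n : ℕ} (g : (Fin n → ℝ) → Matrix (Fin n) (Fin n) ℝ) (f : (Fin n → ℝ) → ℝ)
    (x v w : Fin n → ℝ) : ℝ :=
  ∑ i, ∑ j, hessC g f i j x * v i * w j

/-- The Laplace–Beltrami operator `Δf = div (∇ f) = tr_g ∇²f`. -/
def lap {n : ℕ} (g : (Fin n → ℝ) → Matrix (Fin n) (Fin n) ℝ) (f : (Fin n → ℝ) → ℝ)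
    (x : Fin n → ℝ) : ℝ :=
  ∑ i, ∑ j, (g x)⁻¹ i j * hessC g f i j x

/-- The squared Hilbert–Schmidt norm `|∇²f|²` of the Hessian of `f`. -/
def hessNormSq {n : ℕ} (g : (Fin n → ℝ) → Matrix (Fin n) (Fin n) ℝ) (f : (Fin n → ℝ) → ℝ)
    (x : Fin n → ℝ) : ℝ :=
  ∑ i, ∑ j, ∑ k, ∑ l,
    (g x)⁻¹ i k * (g x)⁻¹ j l * hessC g f i j x * hessC g f k l x

/-- The vector field `X = ∇f / |∇f|²`. -/
def vecX {n : ℕ} (g : (Fin n → ℝ) → Matrix (Fin n) (Fin n) ℝ) (f : (Fin n → ℝ) → ℝ)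
    (x : Fin n → ℝ) : Fin n → ℝ :=
  fun i => grad g f x i / gradNormSq g f x

/-- `|X|²` for `X = ∇f / |∇f|²`. -/
def xNormSq {n : ℕ} (g : (Fin n → ℝ) → Matrix (Fin n) (Fin n) ℝ) (f : (Fin n → ℝ) → ℝ)
    (x : Fin n → ℝ) : ℝ :=
  gip g x (vecX g f x) (vecX g f x)

end

section helpers

variable {n : ℕ} {U : Set (Fin n → ℝ)} {g : (Fin n → ℝ) → Matrix (Fin n) (Fin n) ℝ}

/-- Smoothness on `U`. -/
def Sm (U : Set (Fin n → ℝ)) (h : (Fin n → ℝ) → ℝ) : Prop := ContDiffOn ℝ (⊤ : ℕ∞) h U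

lemma Sm.diff {h : (Fin n → ℝ) → ℝ} (hh : Sm U h) (hU : IsOpen U) {x} (hx : x ∈ U) :
    DifferentiableAt ℝ h x :=
  (ContDiffOn.contDiffAt hh (hU.mem_nhds hx)).differentiableAt (by simp)

lemma Sm.pd {h : (Fin n → ℝ) → ℝ} (hh : Sm U h) (hU : IsOpen U) (i : Fin n) :
    Sm U (pd i h) := by
  have := ContDiffOn.fderiv_of_isOpen (m := (⊤ : ℕ∞)) hh hU (by simp)
  exact this.clm_apply contDiffOn_const

lemma Sm.add {h k : (Fin n → ℝ) → ℝ} (hh : Sm U h) (hk : Sm U k) : Sm U (fun x => h x + k x) :=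
  ContDiffOn.add hh hk

lemma Sm.sub {h k : (Fin n → ℝ) → ℝ} (hh : Sm U h) (hk : Sm U k) : Sm U (fun x => h x - k x) :=
  ContDiffOn.sub hh hk

lemma Sm.mul {h k : (Fin n → ℝ) → ℝ} (hh : Sm U h) (hk : Sm U k) : Sm U (fun x => h x * k x) :=
  ContDiffOn.mul hh hk

lemma Sm.const (c : ℝ) : Sm U (fun _ => c) := contDiffOn_const

lemma Sm.sum {ι : Type*} {s : Finset ι} {h : ι → (Fin n → ℝ) → ℝ} (hh : ∀ i, Sm U (h i)) :
    Sm U (fun x => ∑ i ∈ s, h i x) :=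
  ContDiffOn.sum (fun i _ => hh i)

lemma Sm.prod {ι : Type*} {s : Finset ι} {h : ι → (Fin n → ℝ) → ℝ} (hh : ∀ i, Sm U (h i)) :
    Sm U (fun x => ∏ i ∈ s, h i x) :=
  contDiffOn_prod (fun i _ => hh i)

lemma Sm.inv {h : (Fin n → ℝ) → ℝ} (hh : Sm U h) (h0 : ∀ x ∈ U, h x ≠ 0) :
    Sm U (fun x => (h x)⁻¹) := ContDiffOn.inv hh h0

lemma Sm.congr {h k : (Fin n → ℝ) → ℝ} (hh : Sm U h) (e : ∀ x ∈ U, k x = h x) : Sm U k :=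
  ContDiffOn.congr hh e

lemma Sm.det {A : (Fin n → ℝ) → Matrix (Fin n) (Fin n) ℝ} (hA : ∀ i j, Sm U (fun x => A x i j)) :
    Sm U (fun x => (A x).det) := by
  simp only [Matrix.det_apply']
  exact Sm.sum fun σ => (Sm.const _).mul (Sm.prod fun i => hA _ _)

lemma Sm.ginv (hg : IsRiemannianMetricOn g U) (i j : Fin n) : Sm U (fun x => (g x)⁻¹ i j) := by
  have hadj : Sm U (fun x => (g x).adjugate i j) := by
    simp only [Matrix.adjugate_apply]
    apply Sm.det
    intro a b
    by_cases h : a = j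
    · subst h; simp only [Matrix.updateRow_self]; exact Sm.const _
    · simp only [Matrix.updateRow_ne h]; exact hg.1 a b
  have hd : Sm U (fun x => ((g x).det)⁻¹) :=
    (Sm.det hg.1).inv fun x hx => (hg.2 x hx).det_pos.ne'
  refine (hd.mul hadj).congr fun x _ => ?_
  rw [Matrix.inv_def, Ring.inverse_eq_inv']
  rfl

lemma pd_congr {h k : (Fin n → ℝ) → ℝ} (hU : IsOpen U) (e : ∀ x ∈ U, h x = k x) {x} (hx : x ∈ U)
    (i : Fin n) : pd i h x = pd i k x := by
  have : h =ᶠ[nhds x] k := Filter.eventually_of_mem (hU.mem_nhds hx) e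
  unfold pd; rw [this.fderiv_eq]

lemma pd_mul {h k : (Fin n → ℝ) → ℝ} {x} (hh : DifferentiableAt ℝ h x)
    (hk : DifferentiableAt ℝ k x) (i : Fin n) :
    pd i (fun y => h y * k y) x = pd i h x * k x + h x * pd i k x := by
  unfold pd; rw [fderiv_fun_mul hh hk]; simp; ring

lemma pd_add {h k : (Fin n → ℝ) → ℝ} {x} (hh : DifferentiableAt ℝ h x)
    (hk : DifferentiableAt ℝ k x) (i : Fin n) :
    pd i (fun y => h y + k y) x = pd i h x + pd i k x := by
  unfold pd; rw [fderiv_fun_add hh hk]; simp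

lemma pd_sum {ι : Type*} {s : Finset ι} {h : ι → (Fin n → ℝ) → ℝ} {x}
    (hh : ∀ i, DifferentiableAt ℝ (h i) x) (k : Fin n) :
    pd k (fun y => ∑ i ∈ s, h i y) x = ∑ i ∈ s, pd k (h i) x := by
  unfold pd; rw [fderiv_fun_sum fun i _ => hh i]; simp

lemma pd_const (c : ℝ) (x) (k : Fin n) : pd k (fun _ => c) x = 0 := by
  unfold pd; simp

lemma dirDeriv_eq (v : Fin n → ℝ) (h : (Fin n → ℝ) → ℝ) (x) :
    dirDeriv v h x = ∑ i, v i * pd i h x := by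
  unfold dirDeriv pd
  conv_lhs => rw [← Finset.univ_sum_single v]
  rw [map_sum]
  refine Finset.sum_congr rfl fun i _ => ?_
  have : Pi.single i (v i) = v i • (Pi.single i (1:ℝ) : Fin n → ℝ) := by
    rw [← Pi.single_smul]; simp
  rw [this, map_smul, smul_eq_mul]

lemma g_symm (hg : IsRiemannianMetricOn g U) {x} (hx : x ∈ U) (i j : Fin n) :
    g x i j = g x j i := by
  have := (hg.2 x hx).1.apply i j
  simpa using this.symm

lemma ginv_symm (hg : IsRiemannianMetricOn g U) {x} (hx : x ∈ U) (i j : Fin n) :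
    (g x)⁻¹ i j = (g x)⁻¹ j i := by
  have := (hg.2 x hx).1.inv.apply i j
  simpa using this.symm

lemma ginv_mul (hg : IsRiemannianMetricOn g U) {x} (hx : x ∈ U) : (g x)⁻¹ * g x = 1 :=
  Matrix.nonsing_inv_mul _ ((hg.2 x hx).det_pos.ne'.isUnit)

lemma mul_ginv (hg : IsRiemannianMetricOn g U) {x} (hx : x ∈ U) : g x * (g x)⁻¹ = 1 :=
  Matrix.mul_nonsing_inv _ ((hg.2 x hx).det_pos.ne'.isUnit)

lemma christoffel_symm (hU : IsOpen U) (hg : IsRiemannianMetricOn g U) {x} (hx : x ∈ U)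
    (k i j : Fin n) : christoffel g k i j x = christoffel g k j i x := by
  unfold christoffel
  congr 1
  refine Finset.sum_congr rfl fun l _ => ?_
  rw [pd_congr hU (fun y hy => g_symm hg hy i j) hx l]
  ring

lemma pd_comm {f : (Fin n → ℝ) → ℝ} (hU : IsOpen U) (hf : Sm U f) {x} (hx : x ∈ U)
    (i j : Fin n) : pd i (pd j f) x = pd j (pd i f) x := by
  have hc : ContDiffAt ℝ (⊤ : ℕ∞) f x := ContDiffOn.contDiffAt hf (hU.mem_nhds hx)
  have hs : IsSymmSndFDerivAt ℝ f x := hc.isSymmSndFDerivAt (by simp; exact WithTop.coe_le_coe.2 le_top)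
  have hd : DifferentiableAt ℝ (fderiv ℝ f) x :=
    ((ContDiffOn.fderiv_of_isOpen (m := (⊤ : ℕ∞)) hf hU (by simp)).contDiffAt
      (hU.mem_nhds hx)).differentiableAt (by simp)
  have key : ∀ a b : Fin n, pd a (pd b f) x
      = fderiv ℝ (fderiv ℝ f) x (Pi.single a 1) (Pi.single b 1) := by
    intro a b
    have : pd b f = fun y => fderiv ℝ f y (Pi.single b 1) := rfl
    rw [this]; unfold pd
    rw [fderiv_clm_apply hd (differentiableAt_const _)]
    simp
  rw [key, key]
  exact hs _ _

lemma hessC_symm {f : (Fin n → ℝ) → ℝ} (hU : IsOpen U) (hg : IsRiemannianMetricOn g U)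
    (hf : Sm U f) {x} (hx : x ∈ U) (i j : Fin n) : hessC g f i j x = hessC g f j i x := by
  unfold hessC
  rw [pd_comm hU hf hx]
  congr 1
  exact Finset.sum_congr rfl fun k _ => by rw [christoffel_symm hU hg hx]

/-- Derivative of the inverse metric. -/
lemma pd_ginv (hU : IsOpen U) (hg : IsRiemannianMetricOn g U) {x} (hx : x ∈ U) (k i m : Fin n) :
    pd k (fun y => (g y)⁻¹ i m) x
      = - ∑ l, christoffel g i k l x * (g x)⁻¹ l m - ∑ l, christoffel g m k l x * (g x)⁻¹ i l := by
  have hG : ∀ i j, DifferentiableAt ℝ (fun y => (g y)⁻¹ i j) x :=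
    fun i j => (Sm.ginv hg i j).diff hU hx
  have hgd : ∀ i j, DifferentiableAt ℝ (fun y => g y i j) x :=
    fun i j => Sm.diff (hg.1 i j) hU hx
  set dG : Matrix (Fin n) (Fin n) ℝ := Matrix.of fun i j => pd k (fun y => (g y)⁻¹ i j) x with hdG
  set dg : Matrix (Fin n) (Fin n) ℝ := Matrix.of fun i j => pd k (fun y => g y i j) x with hdg
  have h1 : dG * g x + (g x)⁻¹ * dg = 0 := by
    ext a b
    have h2 : pd k (fun y => ∑ j, (g y)⁻¹ a j * g y j b) x = 0 := by
      rw [pd_congr (k := fun _ => (1 : Matrix (Fin n) (Fin n) ℝ) a b) hU _ hx, pd_const]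
      intro y hy
      rw [← ginv_mul hg hy, Matrix.mul_apply]
    rw [pd_sum fun j => (hG a j).fun_mul (hgd j b)] at h2
    simp only [pd_mul (hG _ _) (hgd _ _), Finset.sum_add_distrib] at h2
    simpa [Matrix.mul_apply, hdG, hdg] using h2
  have h3 : dG = - ((g x)⁻¹ * dg * (g x)⁻¹) := by
    have : (dG * g x + (g x)⁻¹ * dg) * (g x)⁻¹ = 0 := by rw [h1, Matrix.zero_mul]
    rw [Matrix.add_mul, Matrix.mul_assoc, mul_ginv hg hx, Matrix.mul_one] at this
    exact eq_neg_of_add_eq_zero_left this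
  have h4 : pd k (fun y => (g y)⁻¹ i m) x
      = - ∑ a, ∑ l, (g x)⁻¹ i a * (g x)⁻¹ l m * pd k (fun y => g y a l) x := by
    have := congrFun (congrFun h3 i) m
    simp only [hdG, Matrix.of_apply] at this
    rw [this, Matrix.neg_apply, Matrix.mul_apply]
    simp only [Matrix.mul_apply, hdg, Matrix.of_apply, Finset.sum_mul]
    rw [Finset.sum_comm]
    congr 1
    exact Finset.sum_congr rfl fun a _ => Finset.sum_congr rfl fun l _ => by ring
  rw [h4]
  have h5 : ∑ l, christoffel g i k l x * (g x)⁻¹ l m = ∑ a, ∑ l, (1/2) * ((g x)⁻¹ i a *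
      (g x)⁻¹ l m * (pd k (fun y => g y l a) x + pd l (fun y => g y k a) x
        - pd a (fun y => g y k l) x)) := by
    unfold christoffel
    rw [Finset.sum_comm]
    refine Finset.sum_congr rfl fun l _ => ?_
    rw [mul_assoc, Finset.sum_mul, Finset.mul_sum]
    exact Finset.sum_congr rfl fun a _ => by ring
  have h6 : ∑ l, christoffel g m k l x * (g x)⁻¹ i l = ∑ a, ∑ l, (1/2) * ((g x)⁻¹ i a *
      (g x)⁻¹ l m * (pd k (fun y => g y a l) x + pd a (fun y => g y k l) x
        - pd l (fun y => g y k a) x)) := by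
    unfold christoffel
    refine Finset.sum_congr rfl fun a _ => ?_
    rw [mul_assoc, Finset.sum_mul, Finset.mul_sum]
    exact Finset.sum_congr rfl fun l _ => by rw [ginv_symm hg hx m l]; ring
  rw [h5, h6, ← neg_add', ← Finset.sum_add_distrib]
  congr 1
  refine Finset.sum_congr rfl fun a _ => ?_
  rw [← Finset.sum_add_distrib]
  refine Finset.sum_congr rfl fun l _ => ?_
  rw [pd_congr hU (fun y hy => g_symm hg hy l a) hx k]
  ring

lemma Sm.christoffel (hU : IsOpen U) (hg : IsRiemannianMetricOn g U) (k i j : Fin n) :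
    Sm U (christoffel g k i j) := by
  unfold _root_.christoffel
  exact (Sm.const _).mul (Sm.sum fun l => (Sm.ginv hg k l).mul
    (((Sm.pd (hg.1 j l) hU i).add (Sm.pd (hg.1 i l) hU j)).sub (Sm.pd (hg.1 i j) hU l)))

lemma Sm.grad {f : (Fin n → ℝ) → ℝ} (hU : IsOpen U) (hg : IsRiemannianMetricOn g U)
    (hf : Sm U f) (i : Fin n) : Sm U (fun x => grad g f x i) := by
  unfold _root_.grad
  exact Sm.sum fun j => (Sm.ginv hg i j).mul (hf.pd hU j)

lemma Sm.hessC {f : (Fin n → ℝ) → ℝ} (hU : IsOpen U) (hg : IsRiemannianMetricOn g U)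
    (hf : Sm U f) (i j : Fin n) : Sm U (hessC g f i j) := by
  unfold _root_.hessC
  exact ((hf.pd hU j).pd hU i).sub (Sm.sum fun k => (Sm.christoffel hU hg k i j).mul (hf.pd hU k))

lemma Sm.gradNormSq {f : (Fin n → ℝ) → ℝ} (hU : IsOpen U) (hg : IsRiemannianMetricOn g U)
    (hf : Sm U f) : Sm U (gradNormSq g f) := by
  unfold _root_.gradNormSq gip
  exact Sm.sum fun i => Sm.sum fun j =>
    (Sm.mul (hg.1 i j) (Sm.grad hU hg hf i)).mul (Sm.grad hU hg hf j)

/-- Components of `∇V`. -/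
noncomputable def covC (g : (Fin n → ℝ) → Matrix (Fin n) (Fin n) ℝ)
    (V : (Fin n → ℝ) → Fin n → ℝ) (i k : Fin n) (x : Fin n → ℝ) : ℝ :=
  pd i (fun y => V y k) x + ∑ j, christoffel g k i j x * V x j

lemma covDeriv_eq (V : (Fin n → ℝ) → Fin n → ℝ) (v x : Fin n → ℝ) (k : Fin n) :
    covDeriv g V v x k = ∑ i, v i * covC g V i k x := by
  unfold covDeriv covC
  rw [← Finset.sum_add_distrib]
  refine Finset.sum_congr rfl fun i _ => ?_
  rw [mul_add, Finset.mul_sum]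
  congr 1
  exact Finset.sum_congr rfl fun j _ => by ring

lemma divVF_eq (V : (Fin n → ℝ) → Fin n → ℝ) (x : Fin n → ℝ) :
    divVF g V x = ∑ k, covC g V k k x := by
  unfold divVF
  simp [covDeriv_eq, Pi.single_apply]

lemma divVF_congr {V W : (Fin n → ℝ) → Fin n → ℝ} (hU : IsOpen U)
    (e : ∀ x ∈ U, ∀ k, V x k = W x k) {x} (hx : x ∈ U) : divVF g V x = divVF g W x := by
  rw [divVF_eq, divVF_eq]
  refine Finset.sum_congr rfl fun k _ => ?_
  unfold covC
  rw [pd_congr hU (fun y hy => e y hy k) hx]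
  simp only [e x hx]

lemma covC_smul {φ : (Fin n → ℝ) → ℝ} {V : (Fin n → ℝ) → Fin n → ℝ} {x}
    (hφ : DifferentiableAt ℝ φ x) (hV : ∀ k, DifferentiableAt ℝ (fun y => V y k) x) (i k : Fin n) :
    covC g (fun y k => φ y * V y k) i k x = φ x * covC g V i k x + pd i φ x * V x k := by
  unfold covC
  rw [pd_mul hφ (hV k), mul_add, Finset.mul_sum]
  have : ∑ j, christoffel g k i j x * (φ x * V x j) = ∑ j, φ x * (christoffel g k i j x * V x j) :=
    Finset.sum_congr rfl fun j _ => by ring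
  rw [this]; ring

lemma divVF_smul {φ : (Fin n → ℝ) → ℝ} {V : (Fin n → ℝ) → Fin n → ℝ} {x}
    (hφ : DifferentiableAt ℝ φ x) (hV : ∀ k, DifferentiableAt ℝ (fun y => V y k) x) :
    divVF g (fun y k => φ y * V y k) x = φ x * divVF g V x + ∑ k, pd k φ x * V x k := by
  simp only [divVF_eq, covC_smul hφ hV, Finset.sum_add_distrib, Finset.mul_sum]

lemma divVF_add {V W : (Fin n → ℝ) → Fin n → ℝ} {x}
    (hV : ∀ k, DifferentiableAt ℝ (fun y => V y k) x)
    (hW : ∀ k, DifferentiableAt ℝ (fun y => W y k) x) :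
    divVF g (fun y k => V y k + W y k) x = divVF g V x + divVF g W x := by
  simp only [divVF_eq, ← Finset.sum_add_distrib]
  refine Finset.sum_congr rfl fun k _ => ?_
  unfold covC
  rw [pd_add (hV k) (hW k)]
  simp only [mul_add, Finset.sum_add_distrib]
  ring

lemma covC_grad {f : (Fin n → ℝ) → ℝ} (hU : IsOpen U) (hg : IsRiemannianMetricOn g U)
    (hf : Sm U f) {x} (hx : x ∈ U) (k m : Fin n) :
    covC g (grad g f) k m x = ∑ j, (g x)⁻¹ m j * hessC g f k j x := by
  have hG : ∀ i j, DifferentiableAt ℝ (fun y => (g y)⁻¹ i j) x :=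
    fun i j => (Sm.ginv hg i j).diff hU hx
  have hF : ∀ j, DifferentiableAt ℝ (pd j f) x := fun j => (hf.pd hU j).diff hU hx
  unfold covC grad hessC
  rw [pd_sum fun j => (hG m j).fun_mul (hF j)]
  simp only [pd_mul (hG _ _) (hF _), pd_ginv hU hg hx]
  simp only [sub_mul, neg_mul, mul_sub, Finset.sum_add_distrib, Finset.sum_sub_distrib,
    Finset.sum_neg_distrib, Finset.mul_sum, Finset.sum_mul]
  rw [Finset.sum_comm (f := fun i l => christoffel g m k l x * (g x)⁻¹ l i * pd i f x)]
  rw [Finset.sum_comm (f := fun i l => christoffel g i k l x * (g x)⁻¹ m l * pd i f x)]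
  have e1 : ∑ y, ∑ i, christoffel g m k y x * (g x)⁻¹ y i * pd i f x
     = ∑ y, ∑ i, christoffel g m k y x * ((g x)⁻¹ y i * pd i f x) :=
    Finset.sum_congr rfl fun a _ => Finset.sum_congr rfl fun b _ => by ring
  have e2 : ∑ y, ∑ i, christoffel g i k y x * (g x)⁻¹ m y * pd i f x
     = ∑ y, ∑ i, (g x)⁻¹ m y * (christoffel g i k y x * pd i f x) :=
    Finset.sum_congr rfl fun a _ => Finset.sum_congr rfl fun b _ => by ring
  rw [e1, e2]
  ring

lemma divVF_grad {f : (Fin n → ℝ) → ℝ} (hU : IsOpen U) (hg : IsRiemannianMetricOn g U)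
    (hf : Sm U f) {x} (hx : x ∈ U) : divVF g (grad g f) x = lap g f x := by
  rw [divVF_eq]; unfold lap
  exact Finset.sum_congr rfl fun k _ => covC_grad hU hg hf hx k k

lemma lower_grad {f : (Fin n → ℝ) → ℝ} (hg : IsRiemannianMetricOn g U) {x} (hx : x ∈ U)
    (i : Fin n) : ∑ j, g x i j * grad g f x j = pd i f x := by
  have h : grad g f x = (g x)⁻¹ *ᵥ (fun j => pd j f x) := rfl
  have : (g x *ᵥ grad g f x) i = pd i f x := by
    rw [h, Matrix.mulVec_mulVec, mul_ginv hg hx, Matrix.one_mulVec]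
  exact this

lemma gradNormSq_eq {f : (Fin n → ℝ) → ℝ} (hg : IsRiemannianMetricOn g U) {x} (hx : x ∈ U) :
    gradNormSq g f x = ∑ i, pd i f x * grad g f x i := by
  unfold gradNormSq gip
  refine Finset.sum_congr rfl fun i _ => ?_
  rw [← lower_grad hg hx i, Finset.sum_mul]
  exact Finset.sum_congr rfl fun j _ => by ring

lemma gradNormSq_pos {f : (Fin n → ℝ) → ℝ} (hg : IsRiemannianMetricOn g U) {x} (hx : x ∈ U)
    (h : grad g f x ≠ 0) : 0 < gradNormSq g f x := by
  have := (hg.2 x hx).dotProduct_mulVec_pos h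
  refine this.trans_eq ?_
  unfold gradNormSq gip
  simp only [dotProduct, Matrix.mulVec, Finset.mul_sum]
  exact Finset.sum_congr rfl fun i _ => Finset.sum_congr rfl fun j _ => by simp; ring

lemma raise_pd {f : (Fin n → ℝ) → ℝ} (hg : IsRiemannianMetricOn g U) {x} (hx : x ∈ U)
    (w : Fin n → ℝ) :
    ∑ i, pd i f x * ∑ j, (g x)⁻¹ i j * w j = ∑ j, grad g f x j * w j := by
  unfold grad
  simp only [Finset.mul_sum, Finset.sum_mul]
  rw [Finset.sum_comm]
  exact Finset.sum_congr rfl fun i _ => Finset.sum_congr rfl fun j _ => by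
    rw [ginv_symm hg hx i j]; ring

lemma pd_gradNormSq {f : (Fin n → ℝ) → ℝ} (hU : IsOpen U) (hg : IsRiemannianMetricOn g U)
    (hf : Sm U f) {x} (hx : x ∈ U) (k : Fin n) :
    pd k (gradNormSq g f) x = 2 * ∑ j, hessC g f k j x * grad g f x j := by
  have hF : ∀ j, DifferentiableAt ℝ (pd j f) x := fun j => (hf.pd hU j).diff hU hx
  have hV : ∀ j, DifferentiableAt ℝ (fun y => grad g f y j) x :=
    fun j => (Sm.grad hU hg hf j).diff hU hx
  rw [pd_congr hU (fun y hy => gradNormSq_eq hg hy) hx, pd_sum fun j => (hF j).fun_mul (hV j)]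
  simp only [pd_mul (hF _) (hV _), Finset.sum_add_distrib]
  have h1 : ∀ i, pd k (fun y => grad g f y i) x = ∑ j, (g x)⁻¹ i j * hessC g f k j x
      - ∑ j, christoffel g i k j x * grad g f x j := by
    intro i
    rw [← covC_grad hU hg hf hx, covC]; ring
  simp only [h1, mul_sub, Finset.sum_sub_distrib]
  rw [raise_pd hg hx]
  have h2 : ∑ j, hessC g f k j x * grad g f x j = ∑ j, pd k (pd j f) x * grad g f x j
      - ∑ i, pd i f x * ∑ j, christoffel g i k j x * grad g f x j := by
    unfold hessC
    simp only [sub_mul, Finset.sum_sub_distrib, Finset.sum_mul, Finset.mul_sum]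
    congr 1
    rw [Finset.sum_comm]
    exact Finset.sum_congr rfl fun i _ => Finset.sum_congr rfl fun j _ => by ring
  have h3 : ∑ j, grad g f x j * hessC g f k j x = ∑ j, hessC g f k j x * grad g f x j :=
    Finset.sum_congr rfl fun j _ => by ring
  rw [h3]
  linarith

lemma frame_sum (hg : IsRiemannianMetricOn g U) {p} (hp : p ∈ U)
    (e : Fin n → Fin n → ℝ)
    (he : ∀ a b, gip g p (e a) (e b) = if a = b then 1 else 0) (w : Fin n → ℝ) :
    ∑ a, (∑ i, e a i * w i) ^ 2 = ∑ i, ∑ j, (g p)⁻¹ i j * w i * w j := by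
  set E : Matrix (Fin n) (Fin n) ℝ := Matrix.of e with hE
  have h1 : E * (g p * Eᵀ) = 1 := by
    ext a b
    rw [Matrix.one_apply, ← he a b]
    simp only [gip, Matrix.mul_apply, Finset.mul_sum, hE, Matrix.of_apply, Matrix.transpose_apply]
    exact Finset.sum_congr rfl fun i _ => Finset.sum_congr rfl fun j _ => by ring
  have h2 : g p * (Eᵀ * E) = 1 := by
    rw [← Matrix.mul_assoc]; exact mul_eq_one_comm.mp h1
  have h3 : (g p)⁻¹ = Eᵀ * E := Matrix.inv_eq_right_inv h2
  have h4 : ∀ i j, (g p)⁻¹ i j = ∑ a, e a i * e a j := by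
    intro i j
    rw [h3, Matrix.mul_apply]; rfl
  simp only [h4, sq, Finset.sum_mul_sum]
  simp only [Finset.sum_mul]
  rw [Finset.sum_comm]
  refine Finset.sum_congr rfl fun i _ => ?_
  rw [Finset.sum_comm]
  exact Finset.sum_congr rfl fun i _ => Finset.sum_congr rfl fun j _ => by ring

lemma hess_eq (f : (Fin n → ℝ) → ℝ) (x v w : Fin n → ℝ) :
    hess g f x v w = ∑ i, v i * ∑ j, hessC g f i j x * w j := by
  unfold hess
  refine Finset.sum_congr rfl fun i _ => ?_
  rw [Finset.mul_sum]
  exact Finset.sum_congr rfl fun j _ => by ring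

lemma pd_inv {h : (Fin n → ℝ) → ℝ} {x} (hh : DifferentiableAt ℝ h x) (h0 : h x ≠ 0) (i : Fin n) :
    pd i (fun y => (h y)⁻¹) x = - ((h x)⁻¹ ^ 2 * pd i h x) := by
  unfold pd
  have := ((hasDerivAt_inv h0).comp_hasFDerivAt x hh.hasFDerivAt).fderiv
  change fderiv ℝ (fun y => (h y)⁻¹) x = _ at this
  rw [this]
  simp

/-- `∇²f(X,X)` in terms of `∇f`. -/
lemma hess_X (f : (Fin n → ℝ) → ℝ) (x : Fin n → ℝ) :
    hess g f x (vecX g f x) (vecX g f x)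
      = (gradNormSq g f x)⁻¹ ^ 2 * ∑ i, grad g f x i * ∑ j, hessC g f i j x * grad g f x j := by
  rw [hess_eq]
  unfold vecX
  simp only [Finset.mul_sum]
  exact Finset.sum_congr rfl fun i _ => Finset.sum_congr rfl fun j _ => by ring

lemma vecX_eq (f : (Fin n → ℝ) → ℝ) :
    vecX g f = fun y k => (gradNormSq g f y)⁻¹ * grad g f y k := by
  funext y k; unfold vecX; ring

lemma xNormSq_eq {f : (Fin n → ℝ) → ℝ} {x : Fin n → ℝ} (h0 : gradNormSq g f x ≠ 0) :
    xNormSq g f x = (gradNormSq g f x)⁻¹ := by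
  have : xNormSq g f x = (gradNormSq g f x)⁻¹ ^ 2 * gradNormSq g f x := by
    conv_rhs => rw [gradNormSq.eq_def g f x]
    unfold xNormSq gip
    simp only [vecX_eq, Finset.mul_sum]
    refine Finset.sum_congr rfl fun i _ => Finset.sum_congr rfl fun j _ => ?_
    simp only [gradNormSq, gip]; ring
  rw [this]; field_simp

lemma covDeriv_X_X {f : (Fin n → ℝ) → ℝ} (hU : IsOpen U) (hg : IsRiemannianMetricOn g U)
    (hf : Sm U f) {x} (hx : x ∈ U) (h0 : gradNormSq g f x ≠ 0) (k : Fin n) :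
    covDeriv g (vecX g f) (vecX g f x) x k
      = (1 / 2 * ((gradNormSq g f x)⁻¹ * (gradNormSq g f x)⁻¹)) * grad g (gradNormSq g f) x k
        + (-2 * hess g f x (vecX g f x) (vecX g f x)) * vecX g f x k := by
  have hu : DifferentiableAt ℝ (gradNormSq g f) x := (Sm.gradNormSq hU hg hf).diff hU hx
  have hV : ∀ j, DifferentiableAt ℝ (fun y => grad g f y j) x :=
    fun j => (Sm.grad hU hg hf j).diff hU hx
  rw [covDeriv_eq, hess_X]
  have h1 : ∀ i, covC g (vecX g f) i k x = (gradNormSq g f x)⁻¹ * covC g (grad g f) i k x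
      - 2 * (gradNormSq g f x)⁻¹ ^ 2 * (∑ j, hessC g f i j x * grad g f x j) * grad g f x k := by
    intro i
    rw [vecX_eq, covC_smul (hu.fun_inv h0) hV, pd_inv hu h0, pd_gradNormSq hU hg hf hx]
    ring
  have h2 : grad g (gradNormSq g f) x k = 2 * ∑ i, grad g f x i * covC g (grad g f) i k x := by
    simp only [covC_grad hU hg hf hx]
    rw [grad.eq_def g (gradNormSq g f)]
    simp only [pd_gradNormSq hU hg hf hx, Finset.mul_sum]
    rw [Finset.sum_comm]
    refine Finset.sum_congr rfl fun i _ => Finset.sum_congr rfl fun j _ => ?_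
    rw [hessC_symm hU hg hf hx i j]; ring
  rw [h2]
  simp only [h1]
  generalize hu' : gradNormSq g f x = u
  have h3 : ∀ i, vecX g f x i = u⁻¹ * grad g f x i := by
    intro i; rw [vecX_eq, ← hu']
  simp only [h3, mul_sub, Finset.sum_sub_distrib, Finset.mul_sum, Finset.sum_mul]
  rw [sub_eq_add_neg, ← Finset.sum_neg_distrib]
  congr 1
  · exact Finset.sum_congr rfl fun i _ => by ring
  · refine Finset.sum_congr rfl fun i _ => ?_
    rw [← Finset.sum_neg_distrib]
    exact Finset.sum_congr rfl fun j _ => by ring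

end helpers

/-- **Lemma 4.**  If `|∇f| ≠ 0` on an open set `U`, `X = ∇f/|∇f|²`, and `{e₁,…,e_n}` is an
orthonormal frame at `p ∈ U`, then at `p`:
`div(∇_X X) = -2 X(∇²f(X,X)) + 4 ∇²f(X,X)² - 2|X|² ∇²f(X,X) Δf`
`- 4|X|² ∑ i, ∇²f(eᵢ, X)² + (|X|⁴/2) Δ|∇f|²`. -/
theorem div_covDeriv_X_X {n : ℕ}
    (g : (Fin n → ℝ) → Matrix (Fin n) (Fin n) ℝ)
    (U : Set (Fin n → ℝ)) (hU : IsOpen U) (hg : IsRiemannianMetricOn g U)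
    (f : (Fin n → ℝ) → ℝ) (hf : ContDiffOn ℝ (⊤ : ℕ∞) f U)
    (hgrad : ∀ x ∈ U, grad g f x ≠ 0)
    (p : Fin n → ℝ) (hp : p ∈ U)
    (e : Fin n → Fin n → ℝ)
    (he : ∀ a b, gip g p (e a) (e b) = if a = b then 1 else 0) :
    divVF g (fun y => covDeriv g (vecX g f) (vecX g f y) y) p
      = -2 * dirDeriv (vecX g f p) (fun y => hess g f y (vecX g f y) (vecX g f y)) p
        + 4 * (hess g f p (vecX g f p) (vecX g f p)) ^ 2
        - 2 * xNormSq g f p * hess g f p (vecX g f p) (vecX g f p) * lap g f p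
        - 4 * xNormSq g f p * ∑ i, (hess g f p (e i) (vecX g f p)) ^ 2
        + (xNormSq g f p) ^ 2 / 2 * lap g (gradNormSq g f) p := by
  have hf' : Sm U f := hf
  have hsu : Sm U (gradNormSq g f) := Sm.gradNormSq hU hg hf'
  have h0 : ∀ x ∈ U, gradNormSq g f x ≠ 0 := fun x hx => (gradNormSq_pos hg hx (hgrad x hx)).ne'
  have hsi : Sm U (fun y => (gradNormSq g f y)⁻¹) := hsu.inv h0
  have hsX : ∀ k, Sm U (fun y => vecX g f y k) := by
    intro k; rw [vecX_eq]; exact hsi.mul (Sm.grad hU hg hf' k)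
  have hsh : Sm U (fun y => hess g f y (vecX g f y) (vecX g f y)) := by
    unfold hess
    exact Sm.sum fun i => Sm.sum fun j => ((Sm.hessC hU hg hf' i j).mul (hsX i)).mul (hsX j)
  have hs2 : Sm U (fun y => 1 / 2 * ((gradNormSq g f y)⁻¹ * (gradNormSq g f y)⁻¹)) :=
    (Sm.const _).mul (hsi.mul hsi)
  have hs3 : Sm U (fun y => -2 * hess g f y (vecX g f y) (vecX g f y)) := (Sm.const _).mul hsh
  have hsgu : ∀ k, Sm U (fun y => grad g (gradNormSq g f) y k) := Sm.grad hU hg hsu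
  have hdi := hsi.diff hU hp
  have hdh := hsh.diff hU hp
  rw [divVF_congr hU (fun x hx k => covDeriv_X_X hU hg hf' hx (h0 x hx) k) hp,
    divVF_add (fun k => (hs2.mul (hsgu k)).diff hU hp) (fun k => (hs3.mul (hsX k)).diff hU hp),
    divVF_smul (hs2.diff hU hp) (fun k => (hsgu k).diff hU hp),
    divVF_smul (hs3.diff hU hp) (fun k => (hsX k).diff hU hp), divVF_grad hU hg hsu hp]
  have hdivX : divVF g (vecX g f) p = (gradNormSq g f p)⁻¹ * lap g f p
      - 2 * hess g f p (vecX g f p) (vecX g f p) := by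
    rw [hess_X]
    conv_lhs => rw [vecX_eq]
    rw [divVF_smul hdi (fun k => (Sm.grad hU hg hf' k).diff hU hp), divVF_grad hU hg hf' hp,
      sub_eq_add_neg]
    congr 1
    simp only [pd_inv (hsu.diff hU hp) (h0 p hp), pd_gradNormSq hU hg hf' hp, Finset.mul_sum,
      Finset.sum_mul, ← Finset.sum_neg_distrib]
    exact Finset.sum_congr rfl fun i _ => Finset.sum_congr rfl fun j _ => by ring
  have hdir : ∑ k, pd k (fun y => -2 * hess g f y (vecX g f y) (vecX g f y)) p * vecX g f p k
      = -2 * dirDeriv (vecX g f p) (fun y => hess g f y (vecX g f y) (vecX g f y)) p := by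
    rw [dirDeriv_eq, Finset.mul_sum]
    refine Finset.sum_congr rfl fun k _ => ?_
    rw [pd_mul (differentiableAt_const _) hdh, pd_const]
    ring
  have hgu : ∑ k, pd k (fun y => 1 / 2 * ((gradNormSq g f y)⁻¹ * (gradNormSq g f y)⁻¹)) p
        * grad g (gradNormSq g f) p k
      = - 4 * (gradNormSq g f p)⁻¹ * ∑ i, (hess g f p (e i) (vecX g f p)) ^ 2 := by
    simp only [hess_eq]
    rw [frame_sum hg hp e he]
    have hpd : ∀ k, pd k (fun y => 1 / 2 * ((gradNormSq g f y)⁻¹ * (gradNormSq g f y)⁻¹)) p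
        = - ((gradNormSq g f p)⁻¹ ^ 3 * pd k (gradNormSq g f) p) := by
      intro k
      rw [pd_mul (differentiableAt_const _) (hdi.fun_mul hdi), pd_const, pd_mul hdi hdi,
        pd_inv (hsu.diff hU hp) (h0 p hp)]
      ring
    have hw : ∀ k, pd k (gradNormSq g f) p
        = 2 * gradNormSq g f p * ∑ j, hessC g f k j p * vecX g f p j := by
      intro k
      rw [pd_gradNormSq hU hg hf' hp, mul_assoc, Finset.mul_sum (a := gradNormSq g f p)]
      congr 1
      refine Finset.sum_congr rfl fun j _ => ?_
      have := h0 p hp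
      unfold vecX
      field_simp
    simp only [hpd]
    have hgr : ∀ k, grad g (gradNormSq g f) p k
        = ∑ j, (g p)⁻¹ k j * pd j (gradNormSq g f) p := fun k => rfl
    simp only [hgr, hw]
    have := h0 p hp
    set w : Fin n → ℝ := fun k => ∑ j, hessC g f k j p * vecX g f p j with hwd
    have hwk : ∀ k, ∑ j, hessC g f k j p * vecX g f p j = w k := fun k => rfl
    simp only [hwk]
    clear_value w
    rw [Finset.mul_sum]
    refine Finset.sum_congr rfl fun i _ => ?_
    rw [Finset.mul_sum, Finset.mul_sum]
    refine Finset.sum_congr rfl fun j _ => ?_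
    field_simp
    ring
  rw [hdivX, hdir, hgu, xNormSq_eq (h0 p hp)]
  ring
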